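/- arXiv:1405.0810 — 2 statements merged into one kernel-verified Lean document; each statement's English description precedes it below -/
import Mathlib

section
/- Let p, q be coprime integers with q ≥ 1, let ψ : ℝ → ℂ be a C^∞ function with support contained in [1/2,2], let N ≥ 1 be an integer and h ∈ ℝ. Then E_N^ψ(p/q + h) = (1/√q) Σ_{m ∈ ℤ} θ_m · ŵ^ψ_{N²h}(Nm/q), where the series converges absolutely and |θ_m| ≤ √2 for every m ∈ ℤ. -/
open MeasureTheory Filter Set
open scoped Real BigOperators ENNReal

/-- The Gauss sum `τ_m = ∑_{b=0}^{q-1} e^{2πi (p b² + m b)/q}`. -/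
noncomputable def gaussTau (p : ℤ) (q : ℕ) (m : ℤ) : ℂ :=
  ∑ b ∈ Finset.range q,
    Complex.exp (2 * Real.pi * Complex.I * ((p : ℂ) * (b : ℂ) ^ 2 + (m : ℂ) * (b : ℂ)) / (q : ℂ))

/-- `θ_m = τ_m / √q`. -/
noncomputable def gaussTheta (p : ℤ) (q : ℕ) (m : ℤ) : ℂ :=
  gaussTau p q m / (Real.sqrt q : ℂ)

/-- `w_R^ψ(t) = e^{2πi R t²} ψ(t)`. -/
noncomputable def wFun (ψ : ℝ → ℂ) (R : ℝ) (t : ℝ) : ℂ :=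
  Complex.exp (2 * Real.pi * Complex.I * (R : ℂ) * (t : ℂ) ^ 2) * ψ t

/-- The Fourier transform `ŵ_R^ψ(ξ) = ∫ w_R^ψ(t) e^{-2πi t ξ} dt`. -/
noncomputable def wHat (ψ : ℝ → ℂ) (R : ℝ) (ξ : ℝ) : ℂ :=
  ∫ t : ℝ, wFun ψ R t * Complex.exp (-(2 * Real.pi * Complex.I * (t : ℂ) * (ξ : ℂ)))

/-- `E_N^ψ(x) = N⁻¹ ∑_{n ≥ 1} w^ψ_{N²x}(n/N)`. -/
noncomputable def ENpsi (ψ : ℝ → ℂ) (N : ℕ) (x : ℝ) : ℂ :=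
  (N : ℂ)⁻¹ * ∑' n : ℕ, wFun ψ ((N : ℝ) ^ 2 * x) (((n : ℝ) + 1) / N)


lemma gaussTau_eq_zmod (p : ℤ) (q : ℕ) [NeZero q] (m : ℤ) :
    gaussTau p q m =
      ∑ b : ZMod q, ZMod.stdAddChar ((p : ZMod q) * b ^ 2 + (m : ZMod q) * b) := by
  unfold gaussTau
  refine Finset.sum_bij' (fun b _ => (b : ZMod q)) (fun x _ => x.val) ?_ ?_ ?_ ?_ ?_
  · simp
  · intro x _
    exact Finset.mem_range.2 (ZMod.val_lt x)
  · intro b hb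
    exact ZMod.val_cast_of_lt (Finset.mem_range.1 hb)
  · intro x _
    exact ZMod.natCast_zmod_val x
  · intro b _
    have := ZMod.stdAddChar_coe (N := q) (p * (b : ℤ) ^ 2 + m * (b : ℤ))
    push_cast at this
    rw [this]

lemma card_two_torsion (q : ℕ) [NeZero q] :
    (Finset.univ.filter (fun d : ZMod q => 2 * d = 0)).card ≤ 2 := by
  classical
  refine le_trans (Finset.card_le_card (t := {(0 : ZMod q), ((q / 2 : ℕ) : ZMod q)}) ?_)
    Finset.card_le_two
  intro d hd
  have hd' : 2 * d = 0 := (Finset.mem_filter.1 hd).2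
  have hlt := ZMod.val_lt d
  have h0 : ((2 * d.val : ℕ) : ZMod q) = 0 := by
    push_cast
    rw [ZMod.natCast_zmod_val]
    exact hd'
  rw [ZMod.natCast_eq_zero_iff] at h0
  obtain ⟨k, hk⟩ := h0
  have hk2 : k < 2 := by
    by_contra hcon
    have : q * 2 ≤ q * k := Nat.mul_le_mul_left _ (by omega)
    omega
  have hval : d = ((d.val : ℕ) : ZMod q) := (ZMod.natCast_zmod_val d).symm
  have hcases : d.val = 0 ∨ d.val = q / 2 := by
    interval_cases k <;> omega
  rw [Finset.mem_insert, Finset.mem_singleton]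
  rcases hcases with h | h
  · left
    rw [hval, h]; simp
  · right
    rw [hval, h]

lemma gaussTau_sq (p : ℤ) (q : ℕ) [NeZero q] (hpq : IsCoprime p (q : ℤ)) (m : ℤ) :
    ‖gaussTau p q m‖ ^ 2 ≤ 2 * q := by
  classical
  set e : AddChar (ZMod q) ℂ := ZMod.stdAddChar with he
  set P : ZMod q := (p : ZMod q)
  set M : ZMod q := (m : ZMod q)
  have hP : IsUnit P := by
    obtain ⟨a, b, hab⟩ := hpq
    have := congrArg (Int.cast : ℤ → ZMod q) hab
    push_cast at this
    rw [ZMod.natCast_self, mul_zero, add_zero] at this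
    exact IsUnit.of_mul_eq_one (a : ZMod q) (by rw [mul_comm]; exact this)
  have key : ((‖gaussTau p q m‖ ^ 2 : ℝ) : ℂ) =
      ∑ d : ZMod q, e (P * d ^ 2 + M * d) * (if 2 * d = 0 then (q : ℂ) else 0) := by
    rw [Complex.ofReal_pow, ← Complex.mul_conj', gaussTau_eq_zmod, map_sum, Finset.sum_mul_sum,
      Finset.sum_comm]
    calc _ = ∑ c : ZMod q, ∑ d : ZMod q, e (P * d ^ 2 + M * d) * e (c * (P * (2 * d))) := by
          refine Finset.sum_congr rfl fun c _ => ?_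
          rw [← Equiv.sum_comp (Equiv.addLeft c)]
          refine Finset.sum_congr rfl fun d _ => ?_
          rw [← AddChar.map_neg_eq_conj, ← he, ← AddChar.map_add_eq_mul, ← AddChar.map_add_eq_mul]
          congr 1
          simp only [Equiv.coe_addLeft]
          ring
      _ = _ := by
          rw [Finset.sum_comm]
          refine Finset.sum_congr rfl fun d _ => ?_
          rw [← Finset.mul_sum, AddChar.sum_mulShift _ (ZMod.isPrimitive_stdAddChar q)]
          simp only [hP.mul_right_eq_zero, ZMod.card]
          split_ifs <;> simp
  have h1 : ‖gaussTau p q m‖ ^ 2 =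
      ‖∑ d : ZMod q, e (P * d ^ 2 + M * d) * (if 2 * d = 0 then (q : ℂ) else 0)‖ := by
    rw [← key, Complex.norm_real, Real.norm_of_nonneg (by positivity)]
  rw [h1]
  refine (norm_sum_le _ _).trans ?_
  have h2 : ∀ d : ZMod q, ‖e (P * d ^ 2 + M * d) * (if 2 * d = 0 then (q : ℂ) else 0)‖ =
      if 2 * d = 0 then (q : ℝ) else 0 := by
    intro d
    rw [norm_mul, AddChar.norm_apply, one_mul]
    split_ifs <;> simp
  simp only [h2]
  rw [← Finset.sum_filter, Finset.sum_const, nsmul_eq_mul]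
  have := card_two_torsion q
  gcongr
  exact_mod_cast this

lemma gaussTheta_bound (p : ℤ) (q : ℕ) (hq : 1 ≤ q) (hpq : IsCoprime p (q : ℤ)) (m : ℤ) :
    ‖gaussTheta p q m‖ ≤ Real.sqrt 2 := by
  haveI : NeZero q := ⟨by omega⟩
  have hq0 : (0 : ℝ) < q := by exact_mod_cast hq
  have h := gaussTau_sq p q hpq m
  unfold gaussTheta
  rw [norm_div, Complex.norm_real, Real.norm_of_nonneg (Real.sqrt_nonneg _),
    div_le_iff₀ (Real.sqrt_pos.2 hq0), ← Real.sqrt_mul (by norm_num)]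
  exact Real.le_sqrt_of_sq_le h

lemma wFun_contDiff (ψ : ℝ → ℂ) (hψ : ContDiff ℝ (⊤ : ℕ∞) ψ) (R : ℝ) :
    ContDiff ℝ (⊤ : ℕ∞) (wFun ψ R) := by
  unfold wFun
  refine ContDiff.mul (ContDiff.cexp ?_) hψ
  exact contDiff_const.mul (Complex.ofRealCLM.contDiff.pow 2)

lemma wFun_support (ψ : ℝ → ℂ) (hsupp : tsupport ψ ⊆ Set.Icc (1/2 : ℝ) 2) (R t : ℝ)
    (h : wFun ψ R t ≠ 0) : t ∈ Set.Icc (1/2 : ℝ) 2 := by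
  apply hsupp
  apply subset_tsupport
  intro h0
  apply h
  simp [wFun, h0]

lemma sum_residues (q : ℕ) [NeZero q] (F : ℤ → ℂ) (hF : Summable F) :
    ∑' n : ℤ, F n = ∑ b ∈ Finset.range q, ∑' k : ℤ, F (k * q + b) := by
  have h1 : Summable (fun x : ℤ × Fin q => F (x.1 * q + (x.2 : ℕ))) :=
    (Int.divModEquiv q).symm.summable_iff.2 hF
  have h2 : ∑' n : ℤ, F n = ∑' x : ℤ × Fin q, F (x.1 * q + (x.2 : ℕ)) :=
    ((Int.divModEquiv q).symm.tsum_eq F).symm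
  have h3 := (Equiv.prodComm (Fin q) ℤ).summable_iff.2 h1
  rw [h2, ← (Equiv.prodComm (Fin q) ℤ).tsum_eq]
  refine (Summable.tsum_prod h3).trans ?_
  rw [tsum_fintype, Finset.sum_range]
  rfl

open FourierTransform in
theorem poisson_summation_ENpsi (p : ℤ) (q : ℕ) (hq : 1 ≤ q) (hpq : IsCoprime p (q : ℤ))
    (ψ : ℝ → ℂ) (hψ : ContDiff ℝ (⊤ : ℕ∞) ψ) (hsupp : tsupport ψ ⊆ Set.Icc (1/2 : ℝ) 2)
    (N : ℕ) (hN : 1 ≤ N) (h : ℝ) :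
    (Summable fun m : ℤ =>
        ‖gaussTheta p q m * wHat ψ ((N : ℝ) ^ 2 * h) ((N : ℝ) * m / q)‖) ∧
    ENpsi ψ N ((p : ℝ) / q + h) =
      (Real.sqrt q : ℂ)⁻¹ *
        ∑' m : ℤ, gaussTheta p q m * wHat ψ ((N : ℝ) ^ 2 * h) ((N : ℝ) * m / q) ∧
    ∀ m : ℤ, ‖gaussTheta p q m‖ ≤ Real.sqrt 2 := by
  haveI : NeZero q := ⟨by omega⟩
  have hq0 : (0 : ℝ) < q := by exact_mod_cast hq
  have hN0 : (0 : ℝ) < N := by exact_mod_cast hN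
  have hqC : (q : ℂ) ≠ 0 := by exact_mod_cast hq0.ne'
  have hNC : (N : ℂ) ≠ 0 := by exact_mod_cast hN0.ne'
  have hθ := gaussTheta_bound p q hq hpq
  set R : ℝ := (N : ℝ) ^ 2 * h with hR
  have hc : (0 : ℝ) < (q : ℝ) / N := by positivity
  -- the Schwartz function
  have hsm : ContDiff ℝ (⊤ : ℕ∞) (fun t : ℝ => wFun ψ R ((q : ℝ) / N * t)) :=
    (wFun_contDiff ψ hψ R).comp (contDiff_const.mul contDiff_id)
  have hcs : HasCompactSupport (fun t : ℝ => wFun ψ R ((q : ℝ) / N * t)) := by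
    refine HasCompactSupport.intro (K := Set.Icc 0 (2 / ((q : ℝ) / N))) isCompact_Icc ?_
    intro t ht
    by_contra hne
    apply ht
    have hm := wFun_support ψ hsupp R _ hne
    refine ⟨?_, ?_⟩
    · by_contra hcon
      push Not at hcon
      have := mul_neg_of_pos_of_neg hc hcon
      linarith [hm.1]
    · rw [le_div_iff₀ hc]
      linarith [hm.2]
  let g : SchwartzMap ℝ ℂ := hcs.toSchwartzMap hsm
  have hg : ∀ t, g t = wFun ψ R ((q : ℝ) / N * t) := fun t => rfl
  have hFg : ∀ m : ℤ, (𝓕 g) (m : ℝ) = (N : ℂ) / q * wHat ψ R ((N : ℝ) * m / q) := by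
    intro m
    rw [SchwartzMap.fourier_coe, Real.fourier_real_eq_integral_exp_smul]
    have := MeasureTheory.Measure.integral_comp_mul_left
      (fun t : ℝ => wFun ψ R t *
        Complex.exp (-(2 * Real.pi * Complex.I * (t : ℂ) * (((N : ℝ) * m / q : ℝ) : ℂ))))
      ((q : ℝ) / N)
    rw [abs_of_pos (inv_pos.2 hc)] at this
    unfold wHat
    rw [Complex.real_smul] at this
    push_cast at this ⊢
    rw [inv_div] at this
    rw [← this]
    congr 1
    ext t
    rw [hg, smul_eq_mul, mul_comm]
    congr 2
    field_simp
  have hsF : Summable (fun m : ℤ => ‖(𝓕 g) (m : ℝ)‖) := by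
    have := summable_of_isBigO (Real.summable_abs_int_rpow one_lt_two)
      (((𝓕 g).isBigO_cocompact_rpow (-2)).comp_tendsto Int.tendsto_coe_cofinite)
    exact this.norm
  have hsW : Summable (fun m : ℤ => ‖wHat ψ R ((N : ℝ) * m / q)‖) := by
    have := hsF.mul_left ((q : ℝ) / N)
    refine this.congr fun m => ?_
    rw [hFg, norm_mul, norm_div, Complex.norm_natCast, Complex.norm_natCast]
    field_simp
  refine ⟨?_, ?_, hθ⟩
  · refine Summable.of_nonneg_of_le (fun _ => norm_nonneg _) (fun m => ?_)
      (hsW.mul_left (Real.sqrt 2))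
    rw [norm_mul]
    exact mul_le_mul_of_nonneg_right (hθ m) (norm_nonneg _)
  · set F : ℤ → ℂ := fun n => wFun ψ ((N : ℝ) ^ 2 * ((p : ℝ) / q + h)) ((n : ℝ) / N) with hFdef
    have hFs : Function.support F ⊆ Set.Icc (1 : ℤ) (2 * N) := by
      intro n hn
      have hm := wFun_support ψ hsupp _ _ hn
      have h1 := hm.1
      have h2 := hm.2
      rw [le_div_iff₀ hN0] at h1
      rw [div_le_iff₀ hN0] at h2
      refine ⟨?_, by exact_mod_cast h2⟩
      have : (0 : ℝ) < n := by nlinarith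
      have : 0 < n := by exact_mod_cast this
      omega
    have hFsum : Summable F :=
      summable_of_hasFiniteSupport ((Set.finite_Icc (1 : ℤ) (2 * N)).subset hFs)
    have hE : ENpsi ψ N ((p : ℝ) / q + h) = (N : ℂ)⁻¹ * ∑' n : ℤ, F n := by
      unfold ENpsi
      congr 1
      have hinj : Function.Injective (fun n : ℕ => (n : ℤ) + 1) := by
        intro a b hab
        simpa using hab
      rw [← hinj.tsum_eq (f := F)]
      · refine tsum_congr fun n => ?_
        simp [hFdef]
      · intro n hn
        have := (hFs hn).1
        exact ⟨(n - 1).toNat, by simp only; omega⟩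
    have hterm : ∀ (b : ℕ) (k : ℤ), F (k * q + b) =
        Complex.exp (2 * Real.pi * Complex.I * ((p : ℂ) * (b : ℂ) ^ 2) / q) *
          g ((b : ℝ) / q + k) := by
      intro b k
      rw [hg, hFdef]
      have harg : (((k * q + b : ℤ) : ℝ)) / N = (q : ℝ) / N * ((b : ℝ) / q + k) := by
        push_cast
        field_simp
        ring
      simp only
      rw [harg]
      unfold wFun
      rw [← mul_assoc, ← Complex.exp_add]
      congr 1
      rw [Complex.exp_eq_exp_iff_exists_int]
      refine ⟨p * (q * k ^ 2 + 2 * k * b), ?_⟩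
      rw [hR]
      push_cast
      field_simp
      ring
    have hP : ∀ b : ℕ, ∑' k : ℤ, g ((b : ℝ) / q + k) =
        ∑' m : ℤ, (𝓕 g) (m : ℝ) * Complex.exp (2 * Real.pi * Complex.I * ((m : ℂ) * b) / q) := by
      intro b
      rw [SchwartzMap.tsum_eq_tsum_fourier]
      refine tsum_congr fun m => ?_
      rw [fourier_coe_apply]
      congr 2
      push_cast
      ring
    have hsb : ∀ b : ℕ, Summable (fun m : ℤ =>
        Complex.exp (2 * Real.pi * Complex.I * ((p : ℂ) * (b : ℂ) ^ 2) / q) *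
        ((𝓕 g) (m : ℝ) * Complex.exp (2 * Real.pi * Complex.I * ((m : ℂ) * b) / q))) := by
      intro b
      refine Summable.mul_left _ (Summable.of_norm (hsF.congr fun m => ?_))
      have : (2 * Real.pi * Complex.I * ((m : ℂ) * b) / q) =
        ((2 * Real.pi * (m * b) / q : ℝ) : ℂ) * Complex.I := by push_cast; ring
      rw [norm_mul, this, Complex.norm_exp_ofReal_mul_I, mul_one]
    rw [hE, sum_residues q F hFsum]
    simp only [hterm, tsum_mul_left, hP]
    simp only [← tsum_mul_left]
    rw [← Summable.tsum_finsetSum (fun b _ => hsb b), ← tsum_mul_left]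
    refine tsum_congr fun m => ?_
    have hsq : ((Real.sqrt q : ℝ) : ℂ) * ((Real.sqrt q : ℝ) : ℂ) = q := by
      rw [← Complex.ofReal_mul, Real.mul_self_sqrt hq0.le]; simp
    have hs0 : ((Real.sqrt q : ℝ) : ℂ) ≠ 0 := by
      intro h0
      rw [h0, zero_mul] at hsq
      exact hqC hsq.symm
    have htau : ∑ b ∈ Finset.range q,
        Complex.exp (2 * Real.pi * Complex.I * ((p : ℂ) * (b : ℂ) ^ 2) / q) *
        ((𝓕 g) (m : ℝ) * Complex.exp (2 * Real.pi * Complex.I * ((m : ℂ) * b) / q)) =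
        gaussTau p q m * (𝓕 g) (m : ℝ) := by
      unfold gaussTau
      rw [Finset.sum_mul]
      refine Finset.sum_congr rfl fun b _ => ?_
      rw [mul_left_comm, ← Complex.exp_add, mul_comm]
      congr 2
      ring
    rw [htau, hFg, gaussTheta, ← hsq]
    field_simp
end

section
/- Let ψ : ℝ → ℂ be a C^∞ function with support contained in [1/2,2]. There exists a constant C, depending only on the sup-norms of finitely many derivatives of ψ, such that for all R > 0 and ξ ∈ ℝ: |ŵ_R^ψ(ξ) − g_R^ψ(ξ)| ≤ C (ρ_{R,ξ} R^{−1/2} + (1 + R + |ξ|)^{−3/2}). -/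
open MeasureTheory Filter Set
open scoped Real BigOperators ENNReal

/-- `g_R^ψ(ξ) = e^{iπ/4} (2R)^{-1/2} e^{-iπξ²/(2R)} ψ(ξ/(2R))`. -/
noncomputable def gR (ψ : ℝ → ℂ) (R : ℝ) (ξ : ℝ) : ℂ :=
  Complex.exp (Complex.I * Real.pi / 4) * ((Real.sqrt (2 * R) : ℂ))⁻¹ *
    Complex.exp (-(Complex.I * Real.pi * (ξ : ℂ) ^ 2 / (2 * (R : ℂ)))) * ψ (ξ / (2 * R))

/-- `ρ_{R,ξ} = 1` if `ξ/(2R) ∈ [1/2,2]` and `R < 1`, and `0` otherwise. -/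
noncomputable def rhoR (R ξ : ℝ) : ℝ :=
  if ξ / (2 * R) ∈ Set.Icc (1/2 : ℝ) 2 ∧ R < 1 then 1 else 0


open scoped FourierTransform

namespace SPhase

lemma tsupport_iter (ψ : ℝ → ℂ) (k : ℕ) : tsupport (iteratedDeriv k ψ) ⊆ tsupport ψ := by
  induction k with
  | zero => simp
  | succ k ih =>
    rw [iteratedDeriv_succ]
    exact fun x hx => ih (tsupport_deriv_subset hx)

lemma int_norm_le (f : ℝ → ℂ) (a S : ℝ) (hz : ∀ t, t ∉ Icc a (a + 3/2) → f t = 0)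
    (hS : ∀ t, ‖f t‖ ≤ S) : ∫ t, ‖f t‖ ≤ 3/2 * S := by
  have h1 : ∫ t, ‖f t‖ = ∫ t in Icc a (a + 3/2), ‖f t‖ := by
    rw [setIntegral_eq_integral_of_forall_compl_eq_zero]
    intro x hx
    simp [hz x hx]
  rw [h1]
  have h2 := norm_setIntegral_le_of_norm_le_const (μ := volume) (s := Icc a (a + 3/2))
    (f := fun t => ‖f t‖) (C := S) (by simp) (fun x _ => by simpa using hS x)
  have h3 := (le_abs_self _).trans h2
  simp [Measure.real] at h3
  rw [ENNReal.toReal_ofReal (by norm_num)] at h3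
  linarith

lemma fourier_bound (φ : ℝ → ℂ) (a S : ℝ) (hφ : ContDiff ℝ (⊤ : ℕ∞) φ)
    (hsup : tsupport φ ⊆ Icc a (a + 3/2))
    (hS : ∀ k ≤ 4, ∀ t, ‖iteratedDeriv k φ t‖ ≤ S) :
    ∀ η : ℝ, ‖𝓕 φ η‖ ≤ 3 * S * (1 + η^2)⁻¹ ∧ η^2 * ‖𝓕 φ η‖ ≤ S / 4 * (1 + η^2)⁻¹ := by
  have hc : ∀ k, HasCompactSupport (iteratedDeriv k φ) := fun k =>
    isCompact_Icc.of_isClosed_subset (isClosed_tsupport _) ((tsupport_iter φ k).trans hsup)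
  have hcont : ∀ k : ℕ, Continuous (iteratedDeriv k φ) := fun k =>
    hφ.continuous_iteratedDeriv k (by exact_mod_cast le_top)
  have hint : ∀ k : ℕ, Integrable (iteratedDeriv k φ) := fun k =>
    (hcont k).integrable_of_hasCompactSupport (hc k)
  have key : ∀ k ≤ 4, ∀ η : ℝ, (2 * π) ^ k * |η| ^ k * ‖𝓕 φ η‖ ≤ 3/2 * S := by
    intro k hk η
    have h := congrFun (Real.fourier_iteratedDeriv (n := k) hφ (fun n _ => hint n)
      (by exact_mod_cast le_top)) η
    have h2 : ‖𝓕 (iteratedDeriv k φ) η‖ ≤ ∫ t, ‖iteratedDeriv k φ t‖ :=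
      VectorFourier.norm_fourierIntegral_le_integral_norm _ _ _ _ _
    have h3 := int_norm_le (iteratedDeriv k φ) a S (fun t ht => image_eq_zero_of_notMem_tsupport
      (fun h => ht (hsup (tsupport_iter φ k h)))) (hS k hk)
    rw [h] at h2
    simp [abs_of_pos Real.pi_pos] at h2
    rw [← mul_pow]
    exact h2.trans h3
  intro η
  have k0 := key 0 (by norm_num) η
  have k2 := key 2 (by norm_num) η
  have k4 := key 4 (by norm_num) η
  have e4 : |η|^4 = η^4 := by rw [show (4:ℕ) = 2*2 by rfl, pow_mul, sq_abs, ← pow_mul]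
  rw [sq_abs] at k2
  rw [e4] at k4
  have hN := norm_nonneg (𝓕 φ η)
  have hp : (36:ℝ) ≤ (2*π)^2 := by nlinarith [Real.pi_gt_three]
  have hp4 : (36:ℝ) ≤ (2*π)^4 := by nlinarith
  have hS0 : 0 ≤ S := (norm_nonneg _).trans (hS 0 (by norm_num) 0)
  have a2 : 36 * (η^2 * ‖𝓕 φ η‖) ≤ 3/2*S :=
    le_trans (by rw [mul_assoc]; gcongr) k2
  have a4 : 36 * (η^4 * ‖𝓕 φ η‖) ≤ 3/2*S :=
    le_trans (by rw [mul_assoc]; gcongr) k4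
  simp only [pow_zero, one_mul] at k0
  rw [← div_eq_mul_inv, ← div_eq_mul_inv, le_div_iff₀ (by positivity), le_div_iff₀ (by positivity)]
  constructor <;> nlinarith

lemma cpow_half (R : ℝ) (hR : 0 < R) :
    (Complex.I * ((1 / (2 * R) : ℝ) : ℂ)) ^ (1/2 : ℂ) =
      Complex.exp (Complex.I * Real.pi / 4) * ((Real.sqrt (2 * R) : ℂ))⁻¹ := by
  have hx : (0:ℝ) < 1 / (2*R) := by positivity
  have hx' : (((1 / (2 * R) : ℝ)) : ℂ) ≠ 0 := by exact_mod_cast hx.ne'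
  rw [Complex.cpow_def_of_ne_zero (mul_ne_zero Complex.I_ne_zero hx'),
    Complex.log_mul_ofReal _ hx _ Complex.I_ne_zero, Complex.log_I, add_mul, Complex.exp_add, mul_comm]
  congr 1
  · congr 1
    ring
  · have h : Real.exp (Real.log (1 / (2 * R)) * (1/2)) = (Real.sqrt (2*R))⁻¹ := by
      rw [← Real.rpow_def_of_pos hx, ← Real.sqrt_eq_rpow, one_div, Real.sqrt_inv]
    rw [← Complex.ofReal_inv, ← h]
    push_cast
    rfl

end SPhase

namespace SPhase

lemma mult_formula (φ : ℝ → ℂ) (hφ : Integrable φ) (b : ℂ) (hb : 0 < b.re) :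
    ∫ s : ℝ, φ s * Complex.exp (-π / b * s ^ 2) =
      b ^ (1/2 : ℂ) * ∫ η : ℝ, 𝓕 φ η * Complex.exp (-π * b * η ^ 2) := by
  have J : Integrable (fun η : ℝ => Complex.exp (-π * b * η ^ 2)) := by
    have := integrable_cexp_neg_mul_sq (b := π * b)
      (by rw [Complex.re_ofReal_mul]; exact mul_pos Real.pi_pos hb)
    simpa only [neg_mul] using this
  have h : ∫ ξ : ℝ, (𝓕 φ ξ) • Complex.exp (-π * b * ξ ^ 2) =
      ∫ x : ℝ, φ x • 𝓕 (fun η : ℝ => Complex.exp (-π * b * η ^ 2)) x := by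
    simpa using! (VectorFourier.integral_fourierIntegral_smul_eq_flip (L := innerₗ ℝ)
      Real.continuous_fourierChar continuous_inner hφ J)
  rw [fourier_gaussian_pi hb] at h
  simp only [smul_eq_mul] at h
  rw [h, ← integral_const_mul]
  congr 1
  ext s
  have hb0 : b ≠ 0 := by rintro rfl; simp at hb
  have : b ^ (1/2 : ℂ) ≠ 0 := by simp [Complex.cpow_eq_zero_iff, hb0]
  field_simp

lemma limit_formula (φ : ℝ → ℂ) (hφ : Integrable φ) (hF : Integrable (𝓕 φ)) (R : ℝ) (hR : 0 < R) :
    ∫ s : ℝ, φ s * Complex.exp (2 * π * Complex.I * R * s ^ 2) =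
      Complex.exp (Complex.I * Real.pi / 4) * ((Real.sqrt (2 * R) : ℂ))⁻¹ *
        ∫ η : ℝ, 𝓕 φ η * Complex.exp (Complex.I * ((-(π * η ^ 2 / (2 * R)) : ℝ) : ℂ)) := by
  set b : ℝ → ℂ := fun ε => ε + Complex.I * ((1 / (2 * R) : ℝ) : ℂ) with hbdef
  have hre : ∀ ε, (b ε).re = ε := by intro ε; simp [b]
  have him : ∀ ε, (b ε).im = 1 / (2 * R) := by intro ε; simp [b]
  have hbne : ∀ ε, b ε ≠ 0 := by
    intro ε h
    have := him ε
    rw [h] at this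
    simp at this
    exact hR.ne' this
  have hbc : Continuous b := by fun_prop
  have hinv : Continuous (fun ε => (b ε)⁻¹) := hbc.inv₀ hbne
  have hb0 : b 0 = Complex.I * ((1 / (2 * R) : ℝ) : ℂ) := by simp [b]
  have hlim : ∀ {f : ℝ → ℂ}, Continuous f → Tendsto f (nhdsWithin 0 (Ioi 0)) (nhds (f 0)) :=
    fun hf => (hf.tendsto 0).mono_left nhdsWithin_le_nhds
  have L1 : Tendsto (fun ε => ∫ s : ℝ, φ s * Complex.exp (-π / b ε * s ^ 2))
      (nhdsWithin 0 (Ioi 0)) (nhds (∫ s : ℝ, φ s * Complex.exp (-π / b 0 * s ^ 2))) := by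
    apply tendsto_integral_filter_of_dominated_convergence (fun s => ‖φ s‖)
    · refine Eventually.of_forall fun ε => hφ.aestronglyMeasurable.mul ?_
      exact Continuous.aestronglyMeasurable (by fun_prop)
    · filter_upwards [self_mem_nhdsWithin] with ε hε
      refine Eventually.of_forall fun s => ?_
      rw [norm_mul, Complex.norm_exp]
      refine mul_le_of_le_one_right (norm_nonneg _) (Real.exp_le_one_iff.2 ?_)
      have : (-π / b ε * s ^ 2 : ℂ) = ((-(π * s^2) : ℝ) : ℂ) * (b ε)⁻¹ := by
        push_cast; ring
      rw [this, Complex.re_ofReal_mul, Complex.inv_re, hre]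
      have h1 : 0 ≤ ε / Complex.normSq (b ε) := div_nonneg (le_of_lt hε) (Complex.normSq_nonneg _)
      have h2 : 0 ≤ π * s^2 := by positivity
      nlinarith
    · exact hφ.norm
    · refine Eventually.of_forall fun s => ?_
      apply hlim (f := fun ε => φ s * Complex.exp (-π / b ε * s ^ 2))
      simp only [div_eq_mul_inv]
      fun_prop
  have L2 : Tendsto (fun ε => ∫ η : ℝ, 𝓕 φ η * Complex.exp (-π * b ε * η ^ 2))
      (nhdsWithin 0 (Ioi 0)) (nhds (∫ η : ℝ, 𝓕 φ η * Complex.exp (-π * b 0 * η ^ 2))) := by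
    apply tendsto_integral_filter_of_dominated_convergence (fun s => ‖𝓕 φ s‖)
    · refine Eventually.of_forall fun ε => hF.aestronglyMeasurable.mul ?_
      exact Continuous.aestronglyMeasurable (by fun_prop)
    · filter_upwards [self_mem_nhdsWithin] with ε hε
      refine Eventually.of_forall fun s => ?_
      rw [norm_mul, Complex.norm_exp]
      refine mul_le_of_le_one_right (norm_nonneg _) (Real.exp_le_one_iff.2 ?_)
      have : (-π * b ε * s ^ 2 : ℂ) = ((-(π * s^2) : ℝ) : ℂ) * (b ε) := by
        push_cast; ring
      rw [this, Complex.re_ofReal_mul, hre]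
      have h1 : 0 ≤ ε := le_of_lt hε
      have h2 : 0 ≤ π * s^2 := by positivity
      nlinarith
    · exact hF.norm
    · refine Eventually.of_forall fun s => ?_
      apply hlim (f := fun ε => 𝓕 φ s * Complex.exp (-π * b ε * s ^ 2))
      fun_prop
  have L3 : Tendsto (fun ε => b ε ^ (1/2 : ℂ)) (nhdsWithin 0 (Ioi 0)) (nhds (b 0 ^ (1/2 : ℂ))) := by
    have : ContinuousAt (fun ε => b ε ^ (1/2 : ℂ)) 0 := by
      refine ContinuousAt.cpow hbc.continuousAt continuousAt_const ?_
      right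
      rw [him]
      positivity
    exact this.tendsto.mono_left nhdsWithin_le_nhds
  have E := tendsto_nhds_unique (L1.congr' (by
    filter_upwards [self_mem_nhdsWithin] with ε hε
    exact mult_formula φ hφ (b ε) (by rw [hre]; exact hε))) (L3.mul L2)
  have hRc : (R : ℂ) ≠ 0 := by exact_mod_cast hR.ne'
  have hI := Complex.I_mul_I
  rw [hb0, cpow_half R hR] at E
  convert E using 2
  · ext s
    congr 2
    push_cast
    field_simp
    linear_combination ((s : ℂ) ^ 2) * hI
  · congr 1
    ext η
    congr 2
    push_cast
    field_simp

lemma quad_bound (φ : ℝ → ℂ) (a S : ℝ) (hφ : ContDiff ℝ (⊤ : ℕ∞) φ)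
    (hsup : tsupport φ ⊆ Icc a (a + 3/2))
    (hS : ∀ k ≤ 4, ∀ t, ‖iteratedDeriv k φ t‖ ≤ S) (R : ℝ) (hR : 0 < R) :
    ‖(∫ s : ℝ, φ s * Complex.exp (2 * π * Complex.I * R * s ^ 2)) -
      Complex.exp (Complex.I * Real.pi / 4) * ((Real.sqrt (2 * R) : ℂ))⁻¹ * φ 0‖ ≤
      (Real.sqrt (2 * R))⁻¹ * (2 * S / R) := by
  have hS0 : 0 ≤ S := (norm_nonneg _).trans (hS 0 (by norm_num) 0)
  have hc : HasCompactSupport φ :=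
    isCompact_Icc.of_isClosed_subset (isClosed_tsupport _) hsup
  have hint : Integrable φ := hφ.continuous.integrable_of_hasCompactSupport hc
  have hb := fourier_bound φ a S hφ hsup hS
  have hFc : Continuous (𝓕 φ) := 
    VectorFourier.fourierIntegral_continuous Real.continuous_fourierChar
      (L := innerₗ ℝ) continuous_inner hint
  have hF : Integrable (𝓕 φ) := 
    (integrable_inv_one_add_sq.const_mul (3 * S)).mono' hFc.aestronglyMeasurable
      (Eventually.of_forall fun η => (hb η).1)
  have h0 : φ 0 = ∫ η : ℝ, 𝓕 φ η := by
    have := hint.fourierInv_fourier_eq hF (v := 0) hφ.continuous.continuousAt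
    rw [← this, Real.fourierInv_eq]
    simp
  have hi2 : Integrable (fun η : ℝ => 𝓕 φ η * Complex.exp (Complex.I * ((-(π * η ^ 2 / (2 * R)) : ℝ) : ℂ))) := by
    refine hF.mono (hFc.mul (by fun_prop)).aestronglyMeasurable (Eventually.of_forall fun η => ?_)
    rw [norm_mul, mul_comm Complex.I, Complex.norm_exp_ofReal_mul_I, mul_one]
  rw [limit_formula φ hint hF R hR, h0, ← mul_sub, ← integral_sub hi2 hF, norm_mul]
  have e1 : ‖Complex.exp (Complex.I * Real.pi / 4) * ((Real.sqrt (2 * R) : ℂ))⁻¹‖ =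
      (Real.sqrt (2 * R))⁻¹ := by
    rw [norm_mul, show Complex.I * Real.pi / 4 = ((π / 4 : ℝ) : ℂ) * Complex.I by push_cast; ring,
      Complex.norm_exp_ofReal_mul_I, one_mul, norm_inv, Complex.norm_real,
      Real.norm_of_nonneg (Real.sqrt_nonneg _)]
  rw [e1]
  refine mul_le_mul_of_nonneg_left ?_ (by positivity)
  have hle := norm_integral_le_of_norm_le
    (integrable_inv_one_add_sq.const_mul (π / (2 * R) * (S / 4)))
    (f := fun η : ℝ => 𝓕 φ η * Complex.exp (Complex.I * ((-(π * η ^ 2 / (2 * R)) : ℝ) : ℂ)) - 𝓕 φ η)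
    (Eventually.of_forall fun η => by
      have h1 := Real.norm_exp_I_mul_ofReal_sub_one_le (x := -(π * η ^ 2 / (2 * R)))
      rw [← mul_sub_one, norm_mul]
      rw [norm_neg, Real.norm_of_nonneg (by positivity)] at h1
      calc _ ≤ ‖𝓕 φ η‖ * (π * η ^ 2 / (2 * R)) := by gcongr
        _ = π / (2 * R) * (η ^ 2 * ‖𝓕 φ η‖) := by ring
        _ ≤ π / (2 * R) * (S / 4 * (1 + η^2)⁻¹) := by
          exact mul_le_mul_of_nonneg_left (hb η).2 (by positivity)
        _ = _ := by ring)
  refine hle.trans ?_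
  rw [integral_const_mul, integral_univ_inv_one_add_sq]
  have hpi : π * π ≤ 16 := by nlinarith [Real.pi_le_four, Real.pi_pos]
  calc π / (2 * R) * (S / 4) * π = (π * π) * S / (8 * R) := by ring
    _ ≤ 16 * S / (8 * R) := by gcongr
    _ = 2 * S / R := by field_simp; ring

end SPhase

namespace SPhase

/-- The oscillating factor. -/
noncomputable def osc (R ξ t : ℝ) : ℂ :=
  Complex.exp (((2 * π * (R * t ^ 2 - t * ξ) : ℝ) : ℂ) * Complex.I)

lemma norm_osc (R ξ t : ℝ) : ‖osc R ξ t‖ = 1 := Complex.norm_exp_ofReal_mul_I _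

lemma wHat_eq (ψ : ℝ → ℂ) (R ξ : ℝ) : wHat ψ R ξ = ∫ t : ℝ, osc R ξ t * ψ t := by
  unfold wHat wFun osc
  congr 1
  ext t
  rw [mul_right_comm, ← Complex.exp_add]
  congr 2
  push_cast
  ring

lemma hasDerivAt_osc (R ξ t : ℝ) :
    HasDerivAt (osc R ξ) (osc R ξ t * (2 * π * Complex.I * (2 * R * t - ξ))) t := by
  unfold osc
  have h1 : HasDerivAt (fun t : ℝ => 2 * π * (R * t ^ 2 - t * ξ))
      (2 * π * (R * (2 * t) - ξ)) t := by
    have := (((hasDerivAt_pow 2 t).const_mul R).sub ((hasDerivAt_id t).mul_const ξ)).const_mul (2 * π)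
    simpa using this
  have h2 := (h1.ofReal_comp.mul_const Complex.I).cexp
  convert h2 using 1
  push_cast
  ring

lemma zero_ends (f : ℝ → ℂ) (hf : Continuous f) (a b : ℝ) (h : tsupport f ⊆ Icc a b) :
    f a = 0 ∧ f b = 0 := by
  have h1 : Function.support f ⊆ Ioo a b := by
    rw [← interior_Icc]
    exact (hf.isOpen_support.subset_interior_iff).2 ((subset_tsupport f).trans h)
  constructor
  · by_contra hne
    exact lt_irrefl _ (h1 hne).1
  · by_contra hne
    exact lt_irrefl _ (h1 hne).2

lemma ibp_bound (ψ : ℝ → ℂ) (S : ℝ) (hψ : ContDiff ℝ (⊤ : ℕ∞) ψ)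
    (hsup : tsupport ψ ⊆ Icc (1/2) 2)
    (hS : ∀ k ≤ 4, ∀ t, ‖iteratedDeriv k ψ t‖ ≤ S) (R ξ : ℝ) (hR : 0 < R)
    (hξ : 8 * R ≤ |ξ|) : ‖wHat ψ R ξ‖ ≤ 20 * S / ξ ^ 2 := by
  have hX : 0 < |ξ| := by linarith
  have hS0 : 0 ≤ S := (norm_nonneg _).trans (hS 0 (by norm_num) 0)
  have e1 : iteratedDeriv 1 ψ = deriv ψ := iteratedDeriv_one
  have e2 : iteratedDeriv 2 ψ = deriv (deriv ψ) := by
    rw [iteratedDeriv_succ, e1]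
  have hcont : ∀ k : ℕ, Continuous (iteratedDeriv k ψ) := fun k =>
    hψ.continuous_iteratedDeriv k (by exact_mod_cast le_top)
  have c1 : Continuous (deriv ψ) := e1 ▸ hcont 1
  have c2 : Continuous (deriv (deriv ψ)) := e2 ▸ hcont 2
  have d0 : ∀ t, HasDerivAt ψ (deriv ψ t) t := fun t =>
    (hψ.differentiable (by simp) t).hasDerivAt
  have d1 : ∀ t, HasDerivAt (deriv ψ) (deriv (deriv ψ) t) t := fun t => by
    have := hψ.differentiable_iteratedDeriv 1 (by exact_mod_cast WithTop.coe_lt_top _)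
    rw [e1] at this
    exact (this t).hasDerivAt
  have s0 : ∀ t, ‖ψ t‖ ≤ S := fun t => by simpa using hS 0 (by norm_num) t
  have s1 : ∀ t, ‖deriv ψ t‖ ≤ S := fun t => by simpa [e1] using hS 1 (by norm_num) t
  have s2 : ∀ t, ‖deriv (deriv ψ) t‖ ≤ S := fun t => by simpa [e2] using hS 2 (by norm_num) t
  obtain ⟨z1, z2⟩ := zero_ends ψ hψ.continuous _ _ hsup
  obtain ⟨y1, y2⟩ := zero_ends (deriv ψ) c1 _ _ (e1 ▸ (tsupport_iter ψ 1).trans hsup)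
  set q : ℝ → ℂ := fun t => 2 * R * t - ξ with hq
  have dq : ∀ t, HasDerivAt q (2 * R) t := fun t => by
    have := ((hasDerivAt_id t).ofReal_comp.const_mul (2 * R : ℂ)).sub_const (ξ : ℂ)
    simp only [id, Complex.ofReal_one, mul_one] at this
    exact this
  have cq : Continuous q := by fun_prop
  have qn : ∀ t ∈ Icc (1/2 : ℝ) 2, |ξ| / 2 ≤ ‖q t‖ := fun t ht => by
    have : q t = ((2 * R * t - ξ : ℝ) : ℂ) := by simp [q]
    rw [this, Complex.norm_real, Real.norm_eq_abs]
    have h1 : |ξ| ≤ |2 * R * t| + |2 * R * t - ξ| := by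
      have := abs_sub (2 * R * t) (2 * R * t - ξ)
      simpa using this
    have h2 : |2 * R * t| ≤ |ξ| / 2 := by
      rw [abs_of_nonneg (by have := ht.1; positivity)]
      nlinarith [ht.2]
    linarith
  have q0 : ∀ t ∈ Icc (1/2 : ℝ) 2, q t ≠ 0 := fun t ht h => by
    have := qn t ht
    rw [h, norm_zero] at this
    linarith
  set c : ℂ := 2 * π * Complex.I with hc
  have hc0 : c ≠ 0 := by simp [c, Real.pi_ne_zero]
  set h : ℝ → ℂ := fun t => deriv (deriv ψ) t / q t ^ 2 - 6 * R * deriv ψ t / q t ^ 3 +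
    12 * R ^ 2 * ψ t / q t ^ 4 with hh
  set F : ℝ → ℂ := fun t => osc R ξ t * (ψ t / (c * q t) -
    (deriv ψ t / q t ^ 2 - 2 * R * ψ t / q t ^ 3) / c ^ 2) with hFdef
  have cosc : Continuous (osc R ξ) :=
    continuous_iff_continuousAt.2 fun t => (hasDerivAt_osc R ξ t).continuousAt
  have ch : ContinuousOn h (Icc (1/2) 2) := by
    have cc : ∀ n : ℕ, ∀ f : ℝ → ℂ, Continuous f →
        ContinuousOn (fun t => f t / q t ^ n) (Icc (1/2) 2) := fun n f hf =>
      hf.continuousOn.div (cq.pow n).continuousOn fun t ht => pow_ne_zero _ (q0 t ht)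
    exact ((cc 2 _ c2).sub (cc 3 (fun t => 6 * R * deriv ψ t) (by fun_prop))).add
      (cc 4 (fun t => 12 * R ^ 2 * ψ t) (continuous_const.mul hψ.continuous))
  have u : uIcc (1/2 : ℝ) 2 = Icc (1/2) 2 := uIcc_of_le (by norm_num)
  have i1 : IntervalIntegrable (fun t => osc R ξ t * ψ t) volume (1/2) 2 :=
    (cosc.mul hψ.continuous).intervalIntegrable _ _
  have i2 : IntervalIntegrable (fun t => osc R ξ t * h t / c ^ 2) volume (1/2) 2 :=
    ContinuousOn.intervalIntegrable (by rw [u]; exact (cosc.continuousOn.mul ch).div_const _)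
  have FT : ∫ t in (1/2 : ℝ)..2, (osc R ξ t * ψ t - osc R ξ t * h t / c ^ 2) = F 2 - F (1/2) := by
    refine intervalIntegral.integral_eq_sub_of_hasDerivAt (fun t ht => ?_) (i1.sub i2)
    rw [u] at ht
    have hqt := q0 t ht
    have D := (hasDerivAt_osc R ξ t).mul (((d0 t).div ((dq t).const_mul c)
      (mul_ne_zero hc0 hqt)).sub ((((d1 t).div ((dq t).pow 2) (pow_ne_zero 2 hqt)).sub
      (((d0 t).const_mul (2 * R : ℂ)).div ((dq t).pow 3) (pow_ne_zero 3 hqt))).div_const (c ^ 2)))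
    refine D.congr_deriv ?_
    have hqe : (2 * R * t - ξ : ℂ) = q t := rfl
    rw [← hc, hqe]
    simp only [hh, Pi.pow_apply, Pi.sub_apply, Pi.div_apply]
    push_cast
    generalize q t = Q at *
    field_simp
    ring
  have F2 : F 2 - F (1/2) = 0 := by
    simp only [hFdef, z1, z2, y1, y2]
    simp
  rw [F2, intervalIntegral.integral_sub i1 i2, sub_eq_zero] at FT
  have hw : wHat ψ R ξ = ∫ t in (1/2 : ℝ)..2, osc R ξ t * ψ t := by
    rw [wHat_eq, intervalIntegral.integral_of_le (by norm_num), ← integral_Icc_eq_integral_Ioc,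
      setIntegral_eq_integral_of_forall_compl_eq_zero]
    intro t ht
    rw [image_eq_zero_of_notMem_tsupport (fun h => ht (hsup h)), mul_zero]
  rw [hw, FT]
  have hcn : 1 ≤ ‖c ^ 2‖ := by
    have : ‖c‖ = 2 * π := by simp [c, abs_of_pos Real.pi_pos]
    rw [norm_pow, this]
    nlinarith [Real.pi_gt_three]
  have hb : ∀ t ∈ uIoc (1/2 : ℝ) 2, ‖osc R ξ t * h t / c ^ 2‖ ≤ 13 * S / ξ ^ 2 := by
    intro t ht
    have ht' : t ∈ Icc (1/2 : ℝ) 2 := by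
      rw [uIoc_of_le (by norm_num)] at ht
      exact Ioc_subset_Icc_self ht
    have hQ := qn t ht'
    rw [norm_div, norm_mul, norm_osc, one_mul]
    refine (div_le_self (norm_nonneg _) hcn).trans ?_
    have hR8 : R ≤ |ξ| / 8 := by linarith
    have t1 : ‖deriv (deriv ψ) t / q t ^ 2‖ ≤ S / (|ξ| / 2) ^ 2 := by
      rw [norm_div, norm_pow]
      have := s2 t
      gcongr
    have t2 : ‖6 * R * deriv ψ t / q t ^ 3‖ ≤ 6 * (|ξ| / 8) * S / (|ξ| / 2) ^ 3 := by
      rw [norm_div, norm_pow, norm_mul, norm_mul, Complex.norm_real, Real.norm_of_nonneg hR.le]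
      have := s1 t
      norm_num
      gcongr
    have t3 : ‖12 * R ^ 2 * ψ t / q t ^ 4‖ ≤ 12 * (|ξ| / 8) ^ 2 * S / (|ξ| / 2) ^ 4 := by
      rw [norm_div, norm_pow, norm_mul, norm_mul, norm_pow, Complex.norm_real,
        Real.norm_of_nonneg hR.le]
      have := s0 t
      norm_num
      gcongr
    have t4 := norm_add_le (deriv (deriv ψ) t / q t ^ 2 - 6 * R * deriv ψ t / q t ^ 3)
      (12 * R ^ 2 * ψ t / q t ^ 4)
    have t5 := norm_sub_le (deriv (deriv ψ) t / q t ^ 2) (6 * R * deriv ψ t / q t ^ 3)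
    have tt : ‖h t‖ ≤ S / (|ξ| / 2) ^ 2 + 6 * (|ξ| / 8) * S / (|ξ| / 2) ^ 3 +
        12 * (|ξ| / 8) ^ 2 * S / (|ξ| / 2) ^ 4 := by
      simp only [hh]
      linarith
    refine tt.trans (le_of_eq ?_)
    rw [← sq_abs ξ]
    field_simp
    ring
  have := intervalIntegral.norm_integral_le_of_norm_le_const hb
  refine this.trans ?_
  rw [abs_of_pos (by norm_num), div_mul_eq_mul_div]
  refine div_le_div_of_nonneg_right ?_ (sq_nonneg ξ)
  linarith

lemma fourier_side (ψ : ℝ → ℂ) (S : ℝ) (hψ : ContDiff ℝ (⊤ : ℕ∞) ψ)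
    (hsup : tsupport ψ ⊆ Icc (1/2) 2)
    (hS : ∀ k ≤ 4, ∀ t, ‖iteratedDeriv k ψ t‖ ≤ S) (R ξ : ℝ) (hR : 0 < R) :
    ‖wHat ψ R ξ - gR ψ R ξ‖ ≤ (Real.sqrt (2 * R))⁻¹ * (2 * S / R) := by
  set t0 : ℝ := ξ / (2 * R) with ht0
  have hξ : ξ = 2 * R * t0 := by rw [ht0]; field_simp
  have hsup' : tsupport (fun s => ψ (t0 + s)) ⊆ Icc (1/2 - t0) (1/2 - t0 + 3/2) := by
    refine closure_minimal ?_ isClosed_Icc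
    intro s hs
    have := hsup (subset_tsupport ψ hs)
    exact ⟨by linarith [this.1], by linarith [this.2]⟩
  have H := quad_bound (fun s => ψ (t0 + s)) (1/2 - t0) S (hψ.comp (contDiff_const.add contDiff_id))
    hsup' (fun k hk t => by rw [iteratedDeriv_comp_const_add]; exact hS k hk _) R hR
  set e : ℂ := Complex.exp (((-(2 * π * R * t0 ^ 2) : ℝ) : ℂ) * Complex.I) with he
  have hw : wHat ψ R ξ = e * ∫ s : ℝ, ψ (t0 + s) * Complex.exp (2 * π * Complex.I * R * s ^ 2) := by
    rw [wHat_eq, ← integral_add_left_eq_self _ t0, ← integral_const_mul]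
    congr 1
    ext s
    rw [mul_left_comm, mul_comm, he, ← Complex.exp_add, osc, hξ]
    congr 2
    push_cast
    ring
  have hg : gR ψ R ξ = e * (Complex.exp (Complex.I * Real.pi / 4) * ((Real.sqrt (2 * R) : ℂ))⁻¹ *
      ψ (t0 + 0)) := by
    unfold gR
    rw [add_zero, ← ht0]
    have : Complex.exp (-(Complex.I * Real.pi * (ξ : ℂ) ^ 2 / (2 * (R : ℂ)))) = e := by
      rw [he, hξ]
      congr 1
      have hRc : (R : ℂ) ≠ 0 := by exact_mod_cast hR.ne'
      push_cast
      field_simp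
    rw [this]
    ring
  rw [hw, hg, ← mul_sub, norm_mul, he, Complex.norm_exp_ofReal_mul_I, one_mul]
  exact H

end SPhase

/-- stationary phase estimate. There are `n ∈ ℕ` and a constant `C > 0`,
depending only on the sup-norms of the first `n` derivatives of `ψ`, such that for every
`C^∞` function `ψ` supported in `[1/2,2]`, every `R > 0` and every `ξ`:
`|ŵ_R^ψ(ξ) - g_R^ψ(ξ)| ≤ C (ρ_{R,ξ} R^{-1/2} + (1 + R + |ξ|)^{-3/2})`. -/
theorem wHat_stationary_phase :
    ∃ (n : ℕ) (C : ℝ), 0 < C ∧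
      ∀ ψ : ℝ → ℂ, ContDiff ℝ (⊤ : ℕ∞) ψ → tsupport ψ ⊆ Set.Icc (1/2 : ℝ) 2 →
        ∀ R : ℝ, 0 < R → ∀ ξ : ℝ,
          ‖wHat ψ R ξ - gR ψ R ξ‖ ≤
            C * (∑ k ∈ Finset.range (n + 1), ⨆ t : ℝ, ‖iteratedDeriv k ψ t‖) *
              (rhoR R ξ / Real.sqrt R + (1 + R + |ξ|) ^ (-(3/2) : ℝ)) := by
  refine ⟨4, 200, by norm_num, ?_⟩
  intro ψ hψ hsup R hR ξ
  set S := ∑ k ∈ Finset.range (4 + 1), ⨆ t : ℝ, ‖iteratedDeriv k ψ t‖ with hSdef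
  have hS : ∀ k ≤ 4, ∀ t, ‖iteratedDeriv k ψ t‖ ≤ S := by
    intro k hk t
    have hc : HasCompactSupport (iteratedDeriv k ψ) :=
      isCompact_Icc.of_isClosed_subset (isClosed_tsupport _)
        ((SPhase.tsupport_iter ψ k).trans hsup)
    have hcont : Continuous (iteratedDeriv k ψ) :=
      hψ.continuous_iteratedDeriv k (by exact_mod_cast le_top)
    obtain ⟨M, hM⟩ := hc.exists_bound_of_continuous hcont
    have hbd : BddAbove (range fun t : ℝ => ‖iteratedDeriv k ψ t‖) :=
      ⟨M, by rintro _ ⟨t, rfl⟩; exact hM t⟩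
    refine (le_ciSup hbd t).trans ?_
    exact Finset.single_le_sum (f := fun k => ⨆ t : ℝ, ‖iteratedDeriv k ψ t‖)
      (fun i _ => Real.iSup_nonneg fun t => norm_nonneg _) (Finset.mem_range.2 (by omega))
  have hS0 : 0 ≤ S := (norm_nonneg _).trans (hS 0 (by norm_num) 0)
  have s0 : ∀ t, ‖ψ t‖ ≤ S := fun t => by simpa using hS 0 (by norm_num) t
  set Y := 1 + R + |ξ| with hY
  have hX := abs_nonneg ξ
  have hY1 : 1 ≤ Y := by linarith
  have hY0 : 0 < Y := by linarith
  have hP : 0 < Y ^ (-(3/2) : ℝ) := by positivity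
  have hρ : 0 ≤ rhoR R ξ / Real.sqrt R := by
    unfold rhoR
    split_ifs <;> positivity
  have hP2 : (Y ^ 2)⁻¹ ≤ Y ^ (-(3/2) : ℝ) := by
    rw [← Real.rpow_natCast, ← Real.rpow_neg hY0.le]
    exact Real.rpow_le_rpow_of_exponent_le hY1 (by norm_num)
  have fin : ∀ K : ℝ, 0 ≤ K → K ≤ 200 → ‖wHat ψ R ξ - gR ψ R ξ‖ ≤ K * S * Y ^ (-(3/2) : ℝ) →
      ‖wHat ψ R ξ - gR ψ R ξ‖ ≤ 200 * S * (rhoR R ξ / Real.sqrt R + Y ^ (-(3/2) : ℝ)) := by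
    intro K hK0 hK h
    refine h.trans ?_
    gcongr
    linarith
  have g0 : ξ / (2 * R) ∉ Icc (1/2 : ℝ) 2 → gR ψ R ξ = 0 := fun h => by
    unfold gR
    rw [image_eq_zero_of_notMem_tsupport (fun h' => h (hsup h')), mul_zero]
  by_cases hA : 8 * R ≤ |ξ| ∧ 1 ≤ |ξ|
  · have hg : gR ψ R ξ = 0 := g0 fun h => by
      have h2 := h.2
      have h1 := h.1
      rw [div_le_iff₀ (by positivity)] at h2
      rw [le_div_iff₀ (by positivity)] at h1
      rw [abs_of_nonneg (by nlinarith)] at hA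
      linarith [hA.1]
    refine fin 180 (by norm_num) (by norm_num) ?_
    rw [hg, sub_zero]
    refine (SPhase.ibp_bound ψ S hψ hsup hS R ξ hR hA.1).trans ?_
    have hξ2 : 0 < ξ ^ 2 := by rw [← sq_abs]; nlinarith
    have h3 : Y ^ 2 ≤ 9 * ξ ^ 2 := by
      rw [← sq_abs ξ]
      have : Y ≤ 3 * |ξ| := by linarith [hA.1, hA.2]
      nlinarith
    have : 20 * S / ξ ^ 2 ≤ 180 * S * (Y ^ 2)⁻¹ := by
      rw [← div_eq_mul_inv, div_le_div_iff₀ hξ2 (by positivity)]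
      nlinarith
    refine this.trans ?_
    gcongr
  by_cases hB : 1 ≤ R ∧ |ξ| ≤ 8 * R
  · refine fin 80 (by norm_num) (by norm_num) ?_
    refine (SPhase.fourier_side ψ S hψ hsup hS R ξ hR).trans ?_
    have hYR : Y ≤ 10 * R := by linarith [hB.1, hB.2]
    have h1 : Y ^ (-(3/2) : ℝ) = (Real.sqrt Y)⁻¹ * Y⁻¹ := by
      rw [Real.sqrt_eq_rpow, ← Real.rpow_neg hY0.le, ← Real.rpow_neg_one Y, ← Real.rpow_add hY0]
      norm_num
    have h2 : Real.sqrt Y ≤ 4 * Real.sqrt (2 * R) := by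
      rw [show (4:ℝ) = Real.sqrt 16 by rw [show (16:ℝ) = 4^2 by norm_num]; simp,
        ← Real.sqrt_mul (by norm_num)]
      apply Real.sqrt_le_sqrt
      linarith
    have p1 : 0 < Real.sqrt Y := Real.sqrt_pos.2 hY0
    have p2 : 0 < Real.sqrt (2 * R) := Real.sqrt_pos.2 (by positivity)
    have h3 : (Real.sqrt (2 * R))⁻¹ ≤ 4 * (Real.sqrt Y)⁻¹ := by
      rw [← div_eq_mul_inv, inv_eq_one_div, div_le_div_iff₀ p2 p1]
      linarith
    have h4 : 2 * S / R ≤ 20 * S * Y⁻¹ := by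
      rw [← div_eq_mul_inv, div_le_div_iff₀ hR hY0]
      nlinarith
    calc _ ≤ (4 * (Real.sqrt Y)⁻¹) * (20 * S * Y⁻¹) := by gcongr
      _ = 80 * S * Y ^ (-(3/2) : ℝ) := by rw [h1]; ring
  · have hRlt : R < 1 := by
      by_contra hR1
      push Not at hR1
      rcases le_total (8 * R) |ξ| with h | h
      · exact hA ⟨h, by linarith⟩
      · exact hB ⟨hR1, h⟩
    have hXlt : |ξ| ≤ 8 := by
      by_contra h
      push Not at h
      exact hA ⟨by linarith, by linarith⟩
    have hY10 : Y ≤ 10 := by linarith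
    have hPl : (1/100 : ℝ) ≤ Y ^ (-(3/2) : ℝ) := by
      refine le_trans ?_ hP2
      rw [one_div]
      gcongr
      nlinarith
    have hwb : ‖wHat ψ R ξ‖ ≤ 3/2 * S := by
      rw [SPhase.wHat_eq]
      refine (norm_integral_le_integral_norm _).trans ?_
      refine SPhase.int_norm_le _ (1/2) S (fun t ht => ?_) (fun t => ?_)
      · have hz : ψ t = 0 := image_eq_zero_of_notMem_tsupport (fun h => ht (by
          have := hsup h
          exact ⟨this.1, by linarith [this.2]⟩))
        rw [hz, mul_zero]
      · rw [norm_mul, SPhase.norm_osc, one_mul]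
        exact s0 t
    have hgb : ‖gR ψ R ξ‖ ≤ S * (rhoR R ξ / Real.sqrt R) := by
      by_cases hI : ξ / (2 * R) ∈ Icc (1/2 : ℝ) 2
      · have hr : rhoR R ξ = 1 := by
          unfold rhoR
          rw [if_pos ⟨hI, hRlt⟩]
        rw [hr]
        unfold gR
        have n1 : ‖Complex.exp (Complex.I * Real.pi / 4)‖ = 1 := by
          rw [show Complex.I * Real.pi / 4 = ((π / 4 : ℝ) : ℂ) * Complex.I by push_cast; ring,
            Complex.norm_exp_ofReal_mul_I]
        have n2 : ‖Complex.exp (-(Complex.I * Real.pi * (ξ : ℂ) ^ 2 / (2 * (R : ℂ))))‖ = 1 := by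
          rw [show -(Complex.I * Real.pi * (ξ : ℂ) ^ 2 / (2 * (R : ℂ))) =
            ((-(π * ξ ^ 2 / (2 * R)) : ℝ) : ℂ) * Complex.I by push_cast; ring,
            Complex.norm_exp_ofReal_mul_I]
        rw [norm_mul, norm_mul, norm_mul, n1, n2, norm_inv, Complex.norm_real,
          Real.norm_of_nonneg (Real.sqrt_nonneg _), one_mul, mul_one, mul_comm, one_div]
        have p : 0 < Real.sqrt R := Real.sqrt_pos.2 hR
        have := s0 (ξ / (2 * R))
        gcongr
        linarith
      · rw [g0 hI, norm_zero]
        positivity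
    refine (norm_sub_le _ _).trans ?_
    nlinarith [mul_nonneg hS0 hρ, mul_le_mul_of_nonneg_left hPl hS0]
end
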